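/- arXiv:2503.02820 — 4 statements merged into one kernel-verified Lean document; each statement's English description precedes it below -/
import Mathlib

section
/- Let ℓ ∈ ℕ and let X be an element of a real Banach algebra (e.g. a square real matrix). Then Γ_{ℓ+1}(X) = ∫₀¹ α^ℓ Γ_ℓ(α X) dα, where the integral is a Bochner integral over the unit interval. -/
/-- `Γ_ℓ(X) = ∑_{m=0}^∞ X^m / (ℓ+m)!` in a real Banach algebra. -/
noncomputable def Gamma {A : Type*} [NormedRing A] [NormedAlgebra ℝ A] (ℓ : ℕ) (X : A) : A :=
  ∑' m : ℕ, (((ℓ + m).factorial : ℝ))⁻¹ • X ^ m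

theorem summable_norm_inv_factorial_add_smul_pow {A : Type*} [NormedRing A] [NormedAlgebra ℝ A]
    (ℓ : ℕ) (X : A) : Summable fun m : ℕ => ‖(((ℓ + m).factorial : ℝ))⁻¹ • X ^ m‖ := by
  refine (NormedSpace.norm_expSeries_summable' (𝕂 := ℝ) X).of_nonneg_of_le
    (fun _ => norm_nonneg _) fun m => ?_
  rw [norm_smul, norm_smul, Real.norm_of_nonneg (by positivity),
    Real.norm_of_nonneg (by positivity)]
  gcongr
  exact Nat.le_add_left m ℓ

theorem integral_pow_smul_inv_factorial_smul_pow {A : Type*} [NormedRing A] [NormedAlgebra ℝ A]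
    [CompleteSpace A] (ℓ m : ℕ) (X : A) :
    ∫ α in (0:ℝ)..1, α ^ ℓ • (((ℓ + m).factorial : ℝ))⁻¹ • (α • X) ^ m =
      (((ℓ + 1 + m).factorial : ℝ))⁻¹ • X ^ m := by
  have h : ∀ α : ℝ, α ^ ℓ • (((ℓ + m).factorial : ℝ))⁻¹ • (α • X) ^ m =
      α ^ (ℓ + m) • (((ℓ + m).factorial : ℝ))⁻¹ • X ^ m := fun α => by
    rw [smul_pow, smul_smul, smul_smul, smul_smul]
    congr 1
    ring
  simp_rw [h]
  rw [intervalIntegral.integral_smul_const, integral_pow, smul_smul, add_right_comm ℓ 1 m,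
    Nat.factorial_succ]
  congr 1
  push_cast
  simp [mul_comm]

theorem gamma_succ_eq_integral {A : Type*} [NormedRing A] [NormedAlgebra ℝ A]
    [CompleteSpace A] (ℓ : ℕ) (X : A) :
    Gamma (ℓ + 1) X = ∫ α in (0:ℝ)..1, α ^ ℓ • Gamma ℓ (α • X) := by
  have hX := summable_norm_inv_factorial_add_smul_pow ℓ X
  have h : HasSum
      (fun m : ℕ => ∫ α in (0:ℝ)..1, α ^ ℓ • (((ℓ + m).factorial : ℝ))⁻¹ • (α • X) ^ m)
      (∫ α in (0:ℝ)..1, α ^ ℓ • Gamma ℓ (α • X)) := by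
    refine intervalIntegral.hasSum_integral_of_dominated_convergence
      (fun m _ => ‖(((ℓ + m).factorial : ℝ))⁻¹ • X ^ m‖) (fun m => ?_)
      (fun m => .of_forall fun α hα => ?_) (.of_forall fun _ _ => hX)
      intervalIntegrable_const (.of_forall fun α _ => ?_)
    · exact Continuous.aestronglyMeasurable (by fun_prop)
    · rw [Set.uIoc_of_le zero_le_one] at hα
      rw [smul_pow, smul_comm _ (α ^ m), smul_smul, ← pow_add, norm_smul]
      refine mul_le_of_le_one_left (norm_nonneg _) ?_
      rw [norm_pow, Real.norm_of_nonneg hα.1.le]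
      exact pow_le_one₀ hα.1.le hα.2
    · exact (summable_norm_inv_factorial_add_smul_pow ℓ (α • X)).of_norm.hasSum.const_smul _
  simp_rw [integral_pow_smul_inv_factorial_smul_pow] at h
  exact h.tsum_eq
end

section
/- Let ℓ ∈ ℕ and let X, Y, Z be elements of a real Banach algebra (e.g. square real matrices of the same size). Then Γ_{ℓ+1}(X, Y, Z) = ∫₀¹ α^ℓ Γ_ℓ(α X, α Y, α Z) dα, where the integral is a Bochner integral over the unit interval. -/
/-- `Γ_ℓ(X, Y, Z) = ∑_{m=0}^∞ ∑_{n=0}^∞ X^m Y Z^n / (ℓ+m+n+1)!` in a real Banach algebra. -/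
noncomputable def Gamma3 {A : Type*} [NormedRing A] [NormedAlgebra ℝ A]
    (ℓ : ℕ) (X Y Z : A) : A :=
  ∑' m : ℕ, ∑' n : ℕ, (((ℓ + m + n + 1).factorial : ℝ))⁻¹ • (X ^ m * Y * Z ^ n)

theorem norm_pow_mul_mul_pow_le {A : Type*} [SeminormedRing A] (X Y Z : A) (m n : ℕ) :
    ‖X ^ m * Y * Z ^ n‖ ≤ ‖X‖ ^ m * ‖Y‖ * ‖Z‖ ^ n := by
  induction n with
  | zero =>
    induction m with
    | zero => simp
    | succ m ih =>
      simp only [pow_zero, mul_one] at ih ⊢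
      rw [pow_succ', pow_succ', mul_assoc, mul_assoc]
      exact (norm_mul_le _ _).trans (by gcongr)
  | succ n ih =>
    rw [pow_succ, pow_succ, ← mul_assoc, ← mul_assoc]
    exact (norm_mul_le _ _).trans (by gcongr)

theorem norm_gamma3_term_le {A : Type*} [NormedRing A] [NormedAlgebra ℝ A]
    (ℓ : ℕ) (X Y Z : A) (m n : ℕ) :
    ‖((ℓ + m + n + 1).factorial : ℝ)⁻¹ • (X ^ m * Y * Z ^ n)‖ ≤
      ‖Y‖ * ((‖X‖ ^ m / m.factorial) * (‖Z‖ ^ n / n.factorial)) := by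
  have hle : (m.factorial * n.factorial : ℝ) ≤ (ℓ + m + n + 1).factorial := by
    exact_mod_cast (Nat.le_of_dvd (Nat.factorial_pos _)
      (Nat.factorial_mul_factorial_dvd_factorial_add m n)).trans
        (Nat.factorial_le (by omega))
  rw [norm_smul, norm_inv, Real.norm_natCast]
  calc ((ℓ + m + n + 1).factorial : ℝ)⁻¹ * ‖X ^ m * Y * Z ^ n‖
      ≤ (m.factorial * n.factorial : ℝ)⁻¹ * (‖X‖ ^ m * ‖Y‖ * ‖Z‖ ^ n) := by
        gcongr
        exact norm_pow_mul_mul_pow_le X Y Z m n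
    _ = _ := by field_simp

theorem summable_gamma3_bound (x y z : ℝ) :
    Summable fun p : ℕ × ℕ =>
      y * ((x ^ p.1 / p.1.factorial) * (z ^ p.2 / p.2.factorial)) :=
  (summable_mul_of_summable_norm (Real.summable_pow_div_factorial x).norm
    (Real.summable_pow_div_factorial z).norm).mul_left y

theorem hasSum_gamma3 {A : Type*} [NormedRing A] [NormedAlgebra ℝ A] [CompleteSpace A]
    (ℓ : ℕ) (X Y Z : A) :
    HasSum (fun p : ℕ × ℕ =>
      ((ℓ + p.1 + p.2 + 1).factorial : ℝ)⁻¹ • (X ^ p.1 * Y * Z ^ p.2)) (Gamma3 ℓ X Y Z) := by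
  have h : Summable fun p : ℕ × ℕ =>
      ((ℓ + p.1 + p.2 + 1).factorial : ℝ)⁻¹ • (X ^ p.1 * Y * Z ^ p.2) :=
    (summable_gamma3_bound ‖X‖ ‖Y‖ ‖Z‖).of_norm_bounded
      fun p => norm_gamma3_term_le ℓ X Y Z p.1 p.2
  have := h.hasSum
  rwa [h.tsum_prod] at this

theorem smul_gamma3_term_smul {A : Type*} [NormedRing A] [NormedAlgebra ℝ A]
    (ℓ : ℕ) (X Y Z : A) (m n : ℕ) (α : ℝ) :
    α ^ ℓ • ((ℓ + m + n + 1).factorial : ℝ)⁻¹ • ((α • X) ^ m * (α • Y) * (α • Z) ^ n) =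
      α ^ (ℓ + m + n + 1) • ((ℓ + m + n + 1).factorial : ℝ)⁻¹ • (X ^ m * Y * Z ^ n) := by
  simp only [smul_pow, smul_mul_assoc, mul_smul_comm, smul_smul]
  congr 1
  ring

theorem integral_gamma3_term {A : Type*} [NormedRing A] [NormedAlgebra ℝ A] [CompleteSpace A]
    (ℓ : ℕ) (X Y Z : A) (m n : ℕ) :
    ∫ α in (0 : ℝ)..1,
        α ^ (ℓ + m + n + 1) • ((ℓ + m + n + 1).factorial : ℝ)⁻¹ • (X ^ m * Y * Z ^ n) =
      ((ℓ + 1 + m + n + 1).factorial : ℝ)⁻¹ • (X ^ m * Y * Z ^ n) := by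
  rw [intervalIntegral.integral_smul_const, integral_pow, smul_smul,
    show ℓ + 1 + m + n + 1 = (ℓ + m + n + 1) + 1 by ring, Nat.factorial_succ (ℓ + m + n + 1)]
  congr 1
  push_cast
  simp [mul_comm]

theorem gamma3_succ_eq_integral {A : Type*} [NormedRing A] [NormedAlgebra ℝ A]
    [CompleteSpace A] (ℓ : ℕ) (X Y Z : A) :
    Gamma3 (ℓ + 1) X Y Z = ∫ α in (0:ℝ)..1, α ^ ℓ • Gamma3 ℓ (α • X) (α • Y) (α • Z) := by
  have key := intervalIntegral.hasSum_integral_of_dominated_convergence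
    (μ := MeasureTheory.volume) (a := (0 : ℝ)) (b := 1)
    (F := fun (p : ℕ × ℕ) (α : ℝ) => α ^ (ℓ + p.1 + p.2 + 1) •
      ((ℓ + p.1 + p.2 + 1).factorial : ℝ)⁻¹ • (X ^ p.1 * Y * Z ^ p.2))
    (f := fun α => α ^ ℓ • Gamma3 ℓ (α • X) (α • Y) (α • Z))
    (fun p _ => ‖Y‖ * ((‖X‖ ^ p.1 / p.1.factorial) * (‖Z‖ ^ p.2 / p.2.factorial)))
    (fun p => Continuous.aestronglyMeasurable (by fun_prop))
    (fun p => .of_forall fun α hα => by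
      rw [Set.uIoc_of_le zero_le_one] at hα
      rw [norm_smul, norm_pow, Real.norm_of_nonneg hα.1.le]
      exact (mul_le_of_le_one_left (norm_nonneg _) (pow_le_one₀ hα.1.le hα.2)).trans
        (norm_gamma3_term_le ℓ X Y Z p.1 p.2))
    (.of_forall fun _ _ => summable_gamma3_bound ‖X‖ ‖Y‖ ‖Z‖)
    intervalIntegrable_const
    (.of_forall fun α _ => by
      simpa only [smul_gamma3_term_smul] using
        (hasSum_gamma3 ℓ (α • X) (α • Y) (α • Z)).const_smul (α ^ ℓ))
  simp only [integral_gamma3_term] at key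
  exact (hasSum_gamma3 (ℓ + 1) X Y Z).unique key
end

section
/- For all natural numbers m and n, ∫₀¹ α (∫₀¹ (αβ)^m (1−αβ)^n dβ) dα = m!·n!/(m+n+1)! − (m+1)!·n!/(m+n+2)!. -/
theorem integral_pow_mul_one_sub_pow (m n : ℕ) :
    ∫ x in (0:ℝ)..1, x ^ m * (1 - x) ^ n =
      (m.factorial : ℝ) * n.factorial / (m + n + 1).factorial := by
  induction n generalizing m with
  | zero =>
    have h : (m.factorial : ℝ) ≠ 0 := by positivity
    simp [Nat.factorial_succ]
    field_simp
  | succ n ih =>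
    have h : ∀ x : ℝ, x ^ m * (1 - x) ^ (n + 1) =
        x ^ m * (1 - x) ^ n - x ^ (m + 1) * (1 - x) ^ n := fun x => by ring
    simp_rw [h]
    rw [intervalIntegral.integral_sub
      (Continuous.intervalIntegrable (by fun_prop) _ _)
      (Continuous.intervalIntegrable (by fun_prop) _ _), ih, ih,
      show m + 1 + n + 1 = m + n + 1 + 1 by ring, show m + (n + 1) + 1 = m + n + 1 + 1 by ring,
      Nat.factorial_succ (m + n + 1), Nat.factorial_succ m, Nat.factorial_succ n]
    have h : ((m + n + 1).factorial : ℝ) ≠ 0 := by positivity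
    push_cast
    field_simp
    ring

/-- Integrating a primitive of `f` over the unit interval. -/
theorem integral_integral_eq_integral_sub {f : ℝ → ℝ} (hf : Continuous f) :
    ∫ a in (0:ℝ)..1, ∫ t in (0:ℝ)..a, f t =
      (∫ t in (0:ℝ)..1, f t) - ∫ t in (0:ℝ)..1, t * f t := by
  have h := intervalIntegral.integral_mul_deriv_eq_deriv_mul
    (a := (0:ℝ)) (b := 1) (u := fun a => ∫ t in (0:ℝ)..a, f t) (v := fun x => x)
    (u' := f) (v' := fun _ => 1) (fun x _ => hf.integral_hasStrictDerivAt 0 x |>.hasDerivAt)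
    (fun x _ => hasDerivAt_id x) (hf.intervalIntegrable _ _)
    (continuous_const.intervalIntegrable _ _)
  simpa [mul_comm] using h

theorem double_integral_identity (m n : ℕ) :
    (∫ α in (0:ℝ)..1, α * ∫ β in (0:ℝ)..1, (α * β) ^ m * (1 - α * β) ^ n) =
      (m.factorial : ℝ) * n.factorial / (m + n + 1).factorial -
        ((m + 1).factorial : ℝ) * n.factorial / (m + n + 2).factorial := by
  have h : ∀ α : ℝ, (α * ∫ β in (0:ℝ)..1, (α * β) ^ m * (1 - α * β) ^ n) =
      ∫ t in (0:ℝ)..α, t ^ m * (1 - t) ^ n := fun α => by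
    simpa using intervalIntegral.mul_integral_comp_mul_left
      (a := 0) (b := 1) (f := fun t : ℝ => t ^ m * (1 - t) ^ n) α
  simp_rw [h]
  rw [integral_integral_eq_integral_sub (by fun_prop)]
  simp_rw [← mul_assoc, ← pow_succ']
  rw [integral_pow_mul_one_sub_pow, integral_pow_mul_one_sub_pow,
    show m + 1 + n + 1 = m + n + 2 by ring]
end

section
/- (Minimal polynomial of the Ad(SE(3)) Lie algebra) Let φ, ρ ∈ ℝ³ and let ξ^⋏ denote the 6×6 real matrix fromBlocks(φ^∧, ρ^∧; 0, φ^∧). Then (ξ^⋏)⁵ + 2‖φ‖²·(ξ^⋏)³ + ‖φ‖⁴·ξ^⋏ = 0. -/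
/-- The hat (skew-symmetric) map on `ℝ³` (with the Euclidean norm). -/
def hat (φ : EuclideanSpace ℝ (Fin 3)) : Matrix (Fin 3) (Fin 3) ℝ :=
  !![0, -φ 2, φ 1; φ 2, 0, -φ 0; -φ 1, φ 0, 0]

theorem norm_sq_eq_sum_fin_three (φ : EuclideanSpace ℝ (Fin 3)) :
    ‖φ‖ ^ 2 = φ 0 ^ 2 + φ 1 ^ 2 + φ 2 ^ 2 := by
  simp [EuclideanSpace.norm_sq_eq, Fin.sum_univ_three]

theorem hat_pow_three (φ : EuclideanSpace ℝ (Fin 3)) :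
    hat φ ^ 3 = -(‖φ‖ ^ 2 • hat φ) := by
  rw [norm_sq_eq_sum_fin_three, pow_three]
  ext i j
  fin_cases i <;> fin_cases j <;>
    simp [hat, Matrix.mul_apply, Fin.sum_univ_three] <;> ring

/-- The polarized form of `hat_pow_three`. -/
theorem hat_polarized_cube (φ ρ : EuclideanSpace ℝ (Fin 3)) :
    hat φ * (hat φ * hat ρ + hat ρ * hat φ) + hat ρ * (hat φ * hat φ) =
      -(‖φ‖ ^ 2 • hat ρ) - (2 * inner ℝ φ ρ) • hat φ := by
  rw [norm_sq_eq_sum_fin_three, PiLp.inner_apply, Fin.sum_univ_three]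
  ext i j
  fin_cases i <;> fin_cases j <;>
    simp [hat] <;> ring

theorem fromBlocks_hat_pow_three (φ ρ : EuclideanSpace ℝ (Fin 3)) :
    (Matrix.fromBlocks (hat φ) (hat ρ) 0 (hat φ)) ^ 3 =
      -(‖φ‖ ^ 2 • Matrix.fromBlocks (hat φ) (hat ρ) 0 (hat φ)) -
        (2 * inner ℝ φ ρ) • Matrix.fromBlocks 0 (hat φ) 0 0 := by
  have hcube := hat_pow_three φ
  rw [pow_three] at hcube
  rw [pow_three, Matrix.fromBlocks_multiply, Matrix.fromBlocks_multiply]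
  simp only [mul_zero, zero_mul, add_zero, zero_add, hcube, hat_polarized_cube,
    Matrix.fromBlocks_smul, Matrix.fromBlocks_neg, sub_eq_add_neg, Matrix.fromBlocks_add,
    smul_zero, neg_zero]

theorem fromBlocks_hat_sq_mul (φ ρ : EuclideanSpace ℝ (Fin 3)) :
    (Matrix.fromBlocks (hat φ) (hat ρ) 0 (hat φ)) ^ 2 * Matrix.fromBlocks 0 (hat φ) 0 0 =
      -(‖φ‖ ^ 2 • Matrix.fromBlocks 0 (hat φ) 0 0) := by
  have hcube := hat_pow_three φ
  rw [pow_three] at hcube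
  rw [pow_two, mul_assoc, Matrix.fromBlocks_multiply, Matrix.fromBlocks_multiply]
  simp only [mul_zero, zero_mul, add_zero, hcube, Matrix.fromBlocks_smul,
    Matrix.fromBlocks_neg, smul_zero, neg_zero]

theorem ad_se3_minimal_polynomial (φ ρ : EuclideanSpace ℝ (Fin 3)) :
    (Matrix.fromBlocks (hat φ) (hat ρ) 0 (hat φ)) ^ 5 +
        (2 * ‖φ‖ ^ 2) • (Matrix.fromBlocks (hat φ) (hat ρ) 0 (hat φ)) ^ 3 +
        (‖φ‖ ^ 4) • Matrix.fromBlocks (hat φ) (hat ρ) 0 (hat φ) = 0 := by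
  have hpow := pow_add (Matrix.fromBlocks (hat φ) (hat ρ) 0 (hat φ)) 2 3
  have hpow' := pow_succ (Matrix.fromBlocks (hat φ) (hat ρ) 0 (hat φ)) 2
  norm_num only at hpow hpow'
  rw [hpow, fromBlocks_hat_pow_three, mul_sub, mul_neg, mul_smul_comm, mul_smul_comm,
    fromBlocks_hat_sq_mul, ← hpow', fromBlocks_hat_pow_three]
  module
end
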